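/- Let p ≥ 5 be a prime and let D be a nontrivial regular (v,k,λ,μ)-partial difference set in an Abelian group of order v = 8p^3 with k ≤ 4p^3 and Δ = (λ−μ)^2 + 4(k−μ) = 16p^2. Then μ = 2p+2 or μ = 2p−2. -/

import Mathlib

variable {G : Type*} [CommGroup G] [DecidableEq G] [Fintype G]

/-- The number of representations of `g` as `d₁ * d₂⁻¹` with `d₁, d₂ ∈ D`, `d₁ ≠ d₂`. -/
def pdsReps (D : Finset G) (g : G) : ℕ :=
  ((D ×ˢ D).filter (fun x => x.1 ≠ x.2 ∧ x.1 * x.2⁻¹ = g)).card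

/-- `D` is a `(v,k,λ,μ)`-partial difference set in `G`. -/
def IsPDS (D : Finset G) (v k l m : ℕ) : Prop :=
  Fintype.card G = v ∧ D.card = k ∧
  (∀ g : G, g ≠ 1 → g ∈ D → pdsReps D g = l) ∧
  (∀ g : G, g ≠ 1 → g ∉ D → pdsReps D g = m)

/-- `D` is regular: closed under inverses and not containing the identity. -/
def IsRegularPDS (D : Finset G) : Prop :=
  (∀ d ∈ D, d⁻¹ ∈ D) ∧ (1 : G) ∉ D

/-- A regular PDS is trivial if `D ∪ {e}` or `G \ D` is a subgroup. -/
def IsTrivialPDS (D : Finset G) : Prop :=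
  (∃ H : Subgroup G, (H : Set G) = ↑D ∪ {1}) ∨
  (∃ H : Subgroup G, (H : Set G) = (↑D : Set G)ᶜ)

/-- A representation of `g` is determined by its first coordinate. -/
lemma pdsReps_le_card {H : Type*} [CommGroup H] [DecidableEq H] (D : Finset H) (g : H) :
    pdsReps D g ≤ D.card := by
  unfold pdsReps
  refine Finset.card_le_card_of_injOn Prod.fst ?_ ?_
  · intro x hx
    simp only [Finset.coe_filter, Finset.mem_product, Set.mem_ofPred_eq] at hx
    exact hx.1.1
  · rintro ⟨a, b⟩ hx ⟨c, d⟩ hy (rfl : a = c)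
    simp only [Finset.coe_filter, Finset.mem_product, Set.mem_ofPred_eq] at hx hy
    have h : a * b⁻¹ = a * d⁻¹ := hx.2.2.trans hy.2.2.symm
    simpa using h

lemma pdsReps_one {H : Type*} [CommGroup H] [DecidableEq H] (D : Finset H) : pdsReps D 1 = 0 := by
  unfold pdsReps
  rw [Finset.card_eq_zero, Finset.filter_eq_empty_iff]
  rintro ⟨a, b⟩ - ⟨hne, h⟩
  exact hne (mul_inv_eq_one.mp h)

lemma sum_pdsReps (D : Finset G) : ∑ g, pdsReps D g = D.offDiag.card := by
  rw [Finset.card_eq_sum_card_fiberwise (f := fun x : G × G => x.1 * x.2⁻¹)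
    (t := Finset.univ) (fun _ _ => Finset.mem_coe.mpr (Finset.mem_univ _))]
  refine Finset.sum_congr rfl fun g _ => ?_
  unfold pdsReps
  congr 1
  ext x
  simp only [Finset.mem_filter, Finset.mem_product, Finset.mem_offDiag]
  tauto

/-- The standard parameter identity of a regular partial difference set. -/
lemma IsPDS.card_sq {D : Finset G} {v k l m : ℕ} (h : IsPDS D v k l m) (h1 : (1 : G) ∉ D) :
    (k : ℤ) ^ 2 = k + l * k + m * (v - 1 - k) := by
  obtain ⟨hv, hk, hl, hm⟩ := h
  have hsum := sum_pdsReps D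
  rw [← Finset.sum_add_sum_compl D, ← Finset.add_sum_erase Dᶜ _ (Finset.mem_compl.mpr h1),
    pdsReps_one, zero_add,
    Finset.sum_congr rfl (fun g hg => hl g (fun e => h1 (e ▸ hg)) hg),
    Finset.sum_congr rfl (fun g hg => hm g (Finset.ne_of_mem_erase hg)
      (Finset.mem_compl.mp (Finset.mem_of_mem_erase hg))),
    Finset.sum_const, Finset.sum_const, smul_eq_mul, smul_eq_mul, Finset.offDiag_card, hk] at hsum
  have hc : ((Dᶜ.erase 1).card : ℤ) = v - 1 - k := by
    have e1 := Finset.card_erase_add_one (Finset.mem_compl.mpr h1)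
    have e2 := Finset.card_add_card_compl D
    omega
  have hkk : k ≤ k * k := Nat.le_mul_self k
  zify [hkk] at hsum
  rw [hc] at hsum
  linarith

/-- If some non-identity element lies outside `D`, then `μ ≤ k`. -/
lemma IsPDS.mu_le_card {D : Finset G} {v k l m : ℕ} (h : IsPDS D v k l m)
    (hkv : k + 1 < v) : m ≤ k := by
  obtain ⟨hv, hk, -, hm⟩ := h
  obtain ⟨g, hg⟩ : ∃ g, g ∉ insert 1 D := by
    by_contra! hall
    have := Finset.card_insert_le (1 : G) D
    rw [Finset.eq_univ_iff_forall.mpr hall, Finset.card_univ] at this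
    omega
  rw [Finset.mem_insert, not_or] at hg
  rw [← hm g hg.1 hg.2, ← hk]
  exact pdsReps_le_card D g

/-- A regular partial difference set with `μ = 0` is a subgroup minus the identity. -/
lemma IsPDS.isTrivial_of_mu_eq_zero {D : Finset G} {v k l : ℕ} (h : IsPDS D v k l 0)
    (hreg : IsRegularPDS D) : IsTrivialPDS D := by
  refine Or.inl ⟨{ carrier := ↑D ∪ {1}, mul_mem' := ?_, one_mem' := by simp, inv_mem' := ?_ }, rfl⟩
  · intro a b ha hb
    simp only [Set.union_singleton, Set.mem_insert_iff, Finset.mem_coe] at ha hb ⊢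
    rcases ha with rfl | ha
    · simpa using hb
    rcases hb with rfl | hb
    · simp [ha]
    by_contra! hab
    have h0 := h.2.2.2 _ hab.1 hab.2
    unfold pdsReps at h0
    rw [Finset.card_eq_zero, Finset.filter_eq_empty_iff] at h0
    refine h0 (x := (a, b⁻¹)) (Finset.mk_mem_product ha (hreg.1 b hb)) ⟨fun e => hab.1 ?_, by simp⟩
    exact mul_eq_one_iff_eq_inv.mpr e
  · intro a ha
    simp only [Set.union_singleton, Set.mem_insert_iff, Finset.mem_coe] at ha ⊢
    exact ha.imp (by simp) (hreg.1 a)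

/-- An odd square root of `1` modulo a prime `p ≠ 2` is `±1` modulo `2p`. -/
lemma exists_eq_two_mul_mul_add_of_sq {p : ℕ} (hp : p.Prime) (hp2 : p ≠ 2) {t m : ℤ}
    (ht : t ^ 2 = 1 + 2 * p * m) : ∃ s e : ℤ, t = 2 * p * s + e ∧ (e = 1 ∨ e = -1) := by
  have hpi : Prime (p : ℤ) := Nat.prime_iff_prime_int.mp hp
  have hcop : IsCoprime (2 : ℤ) p := by
    rw [show (2 : ℤ) = (2 : ℕ) by rfl, Nat.isCoprime_iff_coprime]
    exact (Nat.coprime_primes Nat.prime_two hp).mpr hp2.symm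
  have hodd : Odd t := by
    have : Odd (t ^ 2) := ⟨p * m, by rw [ht]; ring⟩
    exact Int.Odd.of_mul_left (n := t) (by rwa [← sq])
  obtain ⟨r, hr⟩ := hodd
  have hdvd : (p : ℤ) ∣ (t - 1) * (t + 1) := ⟨2 * m, by linear_combination ht⟩
  rcases hpi.dvd_or_dvd hdvd with h | h
  · obtain ⟨s, hs⟩ := hcop.mul_dvd (⟨r, by linarith⟩ : (2 : ℤ) ∣ t - 1) h
    exact ⟨s, 1, by linarith, .inl rfl⟩
  · obtain ⟨s, hs⟩ := hcop.mul_dvd (⟨r + 1, by linarith⟩ : (2 : ℤ) ∣ t + 1) h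
    exact ⟨s, -1, by linarith, .inr rfl⟩

/-- The integer solutions of the parameter equations, where `b = (λ - μ) / 2`. -/
lemma mu_eq_of_parameters {p : ℕ} (hp : p.Prime) (hp5 : 5 ≤ p) {k m b : ℤ} (hk0 : 0 ≤ k)
    (hk : k ≤ 4 * p ^ 3) (hmk : m ≤ k) (hb : k - m = 4 * p ^ 2 - b ^ 2)
    (hsq : (k - b) ^ 2 = (2 * p) ^ 2 * (1 + 2 * p * m)) :
    m = 0 ∨ m = 2 * p + 2 ∨ m = 2 * p - 2 := by
  have hP : (5 : ℤ) ≤ p := by exact_mod_cast hp5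
  obtain ⟨t, ht⟩ : (2 * p : ℤ) ∣ k - b :=
    (Int.pow_dvd_pow_iff two_ne_zero).mp ⟨_, hsq⟩
  have ht2 : t ^ 2 = 1 + 2 * p * m := by
    have h0 : ((2 * p : ℤ)) ^ 2 ≠ 0 := by positivity
    apply mul_left_cancel₀ h0
    rw [← hsq, ht]; ring
  obtain ⟨s, e, hs, he⟩ := exists_eq_two_mul_mul_add_of_sq hp (by omega) ht2
  generalize (p : ℤ) = P at *
  have hbl : -(2 * P) ≤ b := by nlinarith
  have hbu : b ≤ 2 * P := by nlinarith
  have he2 : e ^ 2 = 1 := by rcases he with rfl | rfl <;> norm_num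
  have hm : m = 2 * P * s ^ 2 + 2 * s * e := by
    apply mul_left_cancel₀ (show 2 * P ≠ 0 by positivity)
    rw [hs] at ht2
    linear_combination he2 - ht2
  have ht_lower : -1 ≤ t := by nlinarith
  have ht_upper : t ≤ 2 * P ^ 2 + 1 := by nlinarith
  have hs0 : 0 ≤ s := by
    by_contra! h
    rcases he with rfl | rfl <;> nlinarith
  have hsP : s ≤ P := by
    by_contra! h
    rcases he with rfl | rfl <;> nlinarith
  have hbb : 0 ≤ b ^ 2 + b := by
    rcases le_or_gt 0 b with h | h <;> nlinarith
  have hs1 : s ≤ 1 := by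
    by_contra! h
    have hconv : 0 ≤ (s - 2) * (P - s) := mul_nonneg (by linarith) (by linarith)
    have hval : b ^ 2 + b = 4 * P ^ 2 + 2 * P * s ^ 2 + 2 * s * e - 4 * P ^ 2 * s - 2 * P * e := by
      rw [hs] at ht
      linear_combination hb - ht + hm
    have hse : 2 * s * e - 2 * P * e ≤ 2 * P := by
      rcases he with rfl | rfl <;> linarith
    nlinarith [mul_nonneg (show 0 ≤ P by linarith) hconv]
  obtain rfl | rfl : s = 0 ∨ s = 1 := by omega
  · left; rw [hm]; ring
  · right
    rcases he with rfl | rfl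
    · left; rw [hm]; ring
    · right; rw [hm]; ring

/-- If `Δ = 16p^2` for a nontrivial regular PDS in an Abelian group of order
`8p^3` with `k ≤ 4p^3`, `p ≥ 5` prime, then `μ = 2p+2` or `μ = 2p-2`. -/
theorem pds_delta_16p2_mu (p : ℕ) (hp : p.Prime) (hp5 : 5 ≤ p)
    {G : Type*} [CommGroup G] [DecidableEq G] [Fintype G]
    (D : Finset G) (k l m : ℕ)
    (hPDS : IsPDS D (8 * p ^ 3) k l m) (hreg : IsRegularPDS D)
    (hnt : ¬ IsTrivialPDS D) (hk : k ≤ 4 * p ^ 3)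
    (hΔ : ((l : ℤ) - m) ^ 2 + 4 * ((k : ℤ) - m) = 16 * p ^ 2) :
    m = 2 * p + 2 ∨ m = 2 * p - 2 := by
  have hp0 : 5 ^ 3 ≤ p ^ 3 := Nat.pow_le_pow_left hp5 3
  have hm0 : m ≠ 0 := by
    rintro rfl
    exact hnt (hPDS.isTrivial_of_mu_eq_zero hreg)
  have hmk := hPDS.mu_le_card (by omega)
  have hcard := hPDS.card_sq hreg.2
  push_cast at hcard
  obtain ⟨b, hb⟩ : (2 : ℤ) ∣ (l : ℤ) - m := by
    refine Int.prime_two.dvd_of_dvd_pow (n := 2) ⟨8 * p ^ 2 - 2 * (k - m), ?_⟩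
    linear_combination hΔ
  rw [hb] at hΔ
  have hkm : (k : ℤ) - m = 4 * p ^ 2 - b ^ 2 := by linarith
  have hsq : ((k : ℤ) - b) ^ 2 = (2 * p) ^ 2 * (1 + 2 * p * m) := by
    linear_combination hcard + hkm + k * hb
  have hmain := mu_eq_of_parameters hp hp5 (Int.natCast_nonneg k) (by exact_mod_cast hk)
    (by exact_mod_cast hmk) hkm hsq
  omega
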